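/- Fix σ ≥ 0 and C > 0, and set φ_ν(x) := J_ν′(x) + (σ/x)·J_ν(x). There exist K > 0 and x₀ > 0 such that for all x ≥ x₀ and all real ν with 0 ≤ ν ≤ x/(1+C): |φ_ν(x) + (2/π)^{1/2}·(x² − ν²)^{1/4}·x^{−1}·sin(πx·g(ν/x) − π/4)| ≤ K·(x² − ν²)^{1/4}·x^{−2}. -/

import Mathlib

open Real MeasureTheory

/-- The Bessel function of real order `ν ≥ 0`:
`J_ν(x) = (1/π)∫₀^π cos(x sin t − ν t) dt − (sin(νπ)/π)∫₀^∞ e^{−x sinh t − ν t} dt`. -/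
noncomputable def besselJnu (ν x : ℝ) : ℝ :=
  (1 / π) * (∫ t in (0:ℝ)..π, Real.cos (x * Real.sin t - ν * t)) -
    (Real.sin (ν * π) / π) * ∫ t in Set.Ioi (0:ℝ), Real.exp (-(x * Real.sinh t) - ν * t)

/-- `g(r) = (1/π)(√(1−r²) − r·arccos r)`. -/
noncomputable def gfun (r : ℝ) : ℝ :=
  (1 / π) * (Real.sqrt (1 - r ^ 2) - r * Real.arccos r)

theorem b_exp_dom (ν x t : ℝ) (hν : 0 ≤ ν) (hx : 0 < x) (ht : 0 < t) :
    Real.exp (-(x * Real.sinh t) - ν * t) ≤ Real.exp (-x * t) ∧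
    Real.sinh t * Real.exp (-(x * Real.sinh t) - ν * t) ≤ 2 / x * Real.exp (-(x/2) * t) := by
  have h1 := Real.self_le_sinh_iff.2 ht.le
  have h2 : 0 ≤ ν * t := by positivity
  constructor
  · rw [Real.exp_le_exp]; nlinarith
  · have e1 := Real.add_one_le_exp (x/2 * Real.sinh t)
    have e2 : Real.sinh t ≤ 2 / x * Real.exp (x/2 * Real.sinh t) := by
      calc Real.sinh t = 2/x * (x/2 * Real.sinh t) := by field_simp
        _ ≤ _ := by gcongr; linarith
    calc _ ≤ 2 / x * Real.exp (x/2 * Real.sinh t) * Real.exp (-(x * Real.sinh t) - ν * t) := by gcongr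
      _ = 2 / x * (Real.exp (x/2 * Real.sinh t) * Real.exp (-(x * Real.sinh t) - ν * t)) := by ring
      _ ≤ _ := by
        rw [← Real.exp_add]
        gcongr
        nlinarith

theorem b_int_Ioi (c : ℝ) (hc : 0 < c) : ∫ t in Set.Ioi (0:ℝ), Real.exp (-c * t) = 1 / c := by
  rw [integral_exp_mul_Ioi (by linarith)]; simp; 

theorem b_intg (ν x : ℝ) (hν : 0 ≤ ν) (hx : 0 < x) :
    IntegrableOn (fun t => Real.exp (-(x * Real.sinh t) - ν * t)) (Set.Ioi 0) := by
  refine Integrable.mono' (integrableOn_exp_mul_Ioi (a := -x) (by linarith) 0)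
    (by fun_prop : Continuous _).aestronglyMeasurable ?_
  refine (ae_restrict_iff' measurableSet_Ioi).2 (Filter.Eventually.of_forall fun t ht => ?_)
  rw [Real.norm_of_nonneg (Real.exp_pos _).le]
  exact (b_exp_dom ν x t hν hx ht).1

theorem b_tail1 (ν x : ℝ) (hν : 0 ≤ ν) (hx : 0 < x) :
    |∫ t in Set.Ioi (0:ℝ), Real.exp (-(x * Real.sinh t) - ν * t)| ≤ 1 / x := by
  rw [← b_int_Ioi x hx, ← Real.norm_eq_abs]
  apply norm_integral_le_of_norm_le (integrableOn_exp_mul_Ioi (a := -x) (by linarith) 0)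
  refine (ae_restrict_iff' measurableSet_Ioi).2 (Filter.Eventually.of_forall fun t ht => ?_)
  rw [Real.norm_of_nonneg (Real.exp_pos _).le]
  exact (b_exp_dom ν x t hν hx ht).1

theorem b_tail2 (ν x : ℝ) (hν : 0 ≤ ν) (hx : 0 < x) :
    |∫ t in Set.Ioi (0:ℝ), -Real.sinh t * Real.exp (-(x * Real.sinh t) - ν * t)| ≤ 4 / x^2 := by
  have : 4 / x^2 = ∫ t in Set.Ioi (0:ℝ), 2/x * Real.exp (-(x/2) * t) := by
    rw [integral_const_mul, b_int_Ioi _ (by positivity)]; field_simp; norm_num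
  rw [this, ← Real.norm_eq_abs]
  apply norm_integral_le_of_norm_le
  · exact (integrableOn_exp_mul_Ioi (a := -(x/2)) (by linarith) 0).const_mul _
  refine (ae_restrict_iff' measurableSet_Ioi).2 (Filter.Eventually.of_forall fun t ht => ?_)
  have hs : 0 < Real.sinh t := Real.sinh_pos_iff.2 ht
  rw [norm_mul, norm_neg, Real.norm_of_nonneg (Real.exp_pos _).le, Real.norm_of_nonneg hs.le]
  exact (b_exp_dom ν x t hν hx ht).2

theorem b_deriv (ν x : ℝ) (hν : 0 ≤ ν) (hx : 0 < x) :
    HasDerivAt (fun y => besselJnu ν y)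
      ((1 / π) * (∫ t in (0:ℝ)..π, -(Real.sin t * Real.sin (x * Real.sin t - ν * t))) -
    (Real.sin (ν * π) / π) * ∫ t in Set.Ioi (0:ℝ), -Real.sinh t * Real.exp (-(x * Real.sinh t) - ν * t)) x := by
  unfold besselJnu
  apply HasDerivAt.sub
  · apply HasDerivAt.const_mul
    refine (intervalIntegral.hasDerivAt_integral_of_dominated_loc_of_deriv_le
      (F := fun y t => Real.cos (y * Real.sin t - ν * t))
      (F' := fun y t => -(Real.sin t * Real.sin (y * Real.sin t - ν * t)))
      (bound := fun _ => 1) (s := Set.univ) Filter.univ_mem ?_ ?_ ?_ ?_ ?_ ?_).2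
    · exact Filter.Eventually.of_forall fun y => (by fun_prop : Continuous _).aestronglyMeasurable
    · exact (by fun_prop : Continuous _).intervalIntegrable _ _
    · exact (by fun_prop : Continuous _).aestronglyMeasurable
    · refine Filter.Eventually.of_forall fun t _ y _ => ?_
      rw [norm_neg, norm_mul]
      have a1 := Real.abs_sin_le_one t
      have a2 := Real.abs_sin_le_one (y * Real.sin t - ν * t)
      exact mul_le_one₀ a1 (norm_nonneg _) a2
    · exact intervalIntegrable_const
    · refine Filter.Eventually.of_forall fun t _ y _ => ?_
      have h : HasDerivAt (fun y => y * Real.sin t - ν * t) (1 * Real.sin t) y :=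
        ((hasDerivAt_id y).mul_const _).sub_const _
      have h2 := h.cos
      rwa [(by ring : -Real.sin (y * Real.sin t - ν * t) * (1 * Real.sin t) =
        -(Real.sin t * Real.sin (y * Real.sin t - ν * t)))] at h2
  · apply HasDerivAt.const_mul
    refine (hasDerivAt_integral_of_dominated_loc_of_deriv_le (μ := volume.restrict (Set.Ioi (0:ℝ)))
      (F := fun y t => Real.exp (-(y * Real.sinh t) - ν * t))
      (F' := fun y t => -Real.sinh t * Real.exp (-(y * Real.sinh t) - ν * t))
      (bound := fun t => 2 / (x/2) * Real.exp (-((x/2)/2) * t)) (s := Set.Ioi (x/2))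
      (Ioi_mem_nhds (by linarith)) ?_ ?_ ?_ ?_ ?_ ?_).2
    · exact Filter.Eventually.of_forall fun y => (by fun_prop : Continuous _).aestronglyMeasurable
    · exact b_intg ν x hν hx
    · exact (by fun_prop : Continuous _).aestronglyMeasurable
    · refine (ae_restrict_iff' measurableSet_Ioi).2 (Filter.Eventually.of_forall fun t ht y hy => ?_)
      have hs : 0 < Real.sinh t := Real.sinh_pos_iff.2 ht
      rw [norm_mul, norm_neg, Real.norm_of_nonneg (Real.exp_pos _).le, Real.norm_of_nonneg hs.le]
      refine le_trans ?_ (b_exp_dom ν (x/2) t hν (by linarith) ht).2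
      have hy' : x/2 < y := hy
      gcongr
    · exact (integrableOn_exp_mul_Ioi (a := -((x/2)/2)) (by linarith) 0).const_mul _
    · refine Filter.Eventually.of_forall fun t y _ => ?_
      have h : HasDerivAt (fun y => -(y * Real.sinh t) - ν * t) (-(1 * Real.sinh t)) y :=
        (((hasDerivAt_id y).mul_const _).neg).sub_const _
      have h2 := h.exp
      rwa [(by ring : Real.exp (-(y * Real.sinh t) - ν * t) * (-(1 * Real.sinh t)) =
        -Real.sinh t * Real.exp (-(y * Real.sinh t) - ν * t))] at h2

/-- exponent `i (sin t - t cos β)` -/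
noncomputable def bG (β : ℝ) (t : ℂ) : ℂ :=
  Complex.I * (Complex.sin t - t * (Real.cos β : ℝ))

theorem b_seg {f P : ℂ → ℂ} {R : ℝ} (hf : Continuous f)
    (hP : ∀ z ∈ Metric.ball (0:ℂ) R, HasDerivAt P (f z) z) (p d : ℂ) (a b : ℝ)
    (hR : ∀ s ∈ Set.uIcc a b, p + s * d ∈ Metric.ball (0:ℂ) R) :
    ∫ s in a..b, f (p + (s:ℂ) * d) * d = P (p + b * d) - P (p + a * d) := by
  apply intervalIntegral.integral_eq_sub_of_hasDerivAt
    (f := fun s : ℝ => P (p + (s:ℂ) * d))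
  · intro s hs
    have h1 := hP _ (hR s hs)
    have h2 : HasDerivAt (fun s : ℝ => p + (s:ℂ) * d) d s := by
      simpa using (((hasDerivAt_id s).ofReal_comp).mul_const d).const_add p
    exact h1.comp s h2
  · apply Continuous.intervalIntegrable
    fun_prop

theorem b_contour {f : ℂ → ℂ} (hf : Differentiable ℂ f) (β δ : ℝ) (hβ : 0 ≤ β) (hβ2 : β ≤ π / 2)
    (hδ : 0 ≤ δ) (hδ1 : δ ≤ 1) (hδβ : δ ≤ β) :
    ∫ t in (0:ℝ)..π, f t =
      (∫ s in (0:ℝ)..δ, f (0 + (s:ℂ) * Complex.I) * Complex.I)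
      + (∫ s in (0:ℝ)..(β - δ), f (δ * Complex.I + (s:ℂ) * 1) * 1)
      + (∫ s in (-δ)..δ, f (β + (s:ℂ) * (1 - Complex.I)) * (1 - Complex.I))
      + (∫ s in (β + δ)..π, f (-(δ * Complex.I) + (s:ℂ) * 1) * 1)
      - (∫ s in (0:ℝ)..δ, f (π + (s:ℂ) * (-Complex.I)) * (-Complex.I)) := by
  have hex : Complex.IsExactOn f (Metric.ball 0 100) :=
    hf.differentiableOn.isExactOn_ball
  obtain ⟨P, hP⟩ := hex
  have hpi := Real.pi_le_four
  have hc := hf.continuous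
  have key : ∀ z : ℂ, |z.re| ≤ 20 → |z.im| ≤ 20 → z ∈ Metric.ball (0:ℂ) 100 := by
    intro z h1 h2
    have := Complex.norm_le_abs_re_add_abs_im z
    simp only [Metric.mem_ball, dist_zero_right]
    linarith
  have h0 : ∫ t in (0:ℝ)..π, f t = ∫ s in (0:ℝ)..π, f (0 + (s:ℂ) * 1) * 1 := by simp
  have hpos := Real.pi_pos
  rw [h0, b_seg hc hP, b_seg hc hP, b_seg hc hP, b_seg hc hP, b_seg hc hP, b_seg hc hP]
  · have e1 : (0:ℂ) + (δ:ℂ) * Complex.I = δ * Complex.I + ((0:ℝ):ℂ) * 1 := by push_cast; ring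
    have e2 : (δ:ℂ) * Complex.I + ((β - δ : ℝ):ℂ) * 1 = β + ((-δ:ℝ):ℂ) * (1 - Complex.I) := by
      push_cast; ring
    have e3 : (β:ℂ) + (δ:ℂ) * (1 - Complex.I) = -(δ * Complex.I) + ((β + δ:ℝ):ℂ) * 1 := by
      push_cast; ring
    have e4 : -((δ:ℂ) * Complex.I) + (π:ℂ) * 1 = π + (δ:ℂ) * (-Complex.I) := by ring
    have e5 : (0:ℂ) + (π:ℂ) * 1 = π + ((0:ℝ):ℂ) * (-Complex.I) := by simp
    have e6 : (0:ℂ) + ((0:ℝ):ℂ) * 1 = 0 + ((0:ℝ):ℂ) * Complex.I := by simp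
    rw [e1, e2, e3, e4, e5, e6]; ring
  all_goals
    intro s hs
    rw [Set.mem_uIcc] at hs
    apply key <;> simp <;> rw [abs_le] <;> constructor <;> rcases hs with hs | hs <;> linarith [hs.1, hs.2]

theorem b_re_G (β a b : ℝ) :
    (bG β (a + b * Complex.I)).re = -(Real.cos a * Real.sinh b - b * Real.cos β) := by
  unfold bG
  rw [Complex.sin_add, Complex.sin_mul_I, Complex.cos_mul_I]
  have h1 : Complex.sin a = ((Real.sin a : ℝ):ℂ) := by simp
  have h2 : Complex.cos a = ((Real.cos a : ℝ):ℂ) := by simp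
  have h3 : Complex.sinh b = ((Real.sinh b : ℝ):ℂ) := by simp
  have h4 : Complex.cosh b = ((Real.cosh b : ℝ):ℂ) := by simp
  rw [h1, h2, h3, h4]
  simp only [Complex.mul_re, Complex.mul_im, Complex.add_re, Complex.add_im, Complex.sub_re,
    Complex.sub_im, Complex.ofReal_re, Complex.ofReal_im, Complex.I_re, Complex.I_im]
  ring

theorem b_norm_sin (a b : ℝ) : ‖Complex.sin (a + b * Complex.I)‖ ≤ Real.cosh b := by
  have h : Complex.sin (a + b * Complex.I) =
     ((Real.sin a * Real.cosh b : ℝ):ℂ) + ((Real.cos a * Real.sinh b : ℝ):ℂ) * Complex.I := by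
    rw [Complex.sin_add, Complex.sin_mul_I, Complex.cos_mul_I]
    push_cast; ring
  rw [h, Complex.norm_add_mul_I]
  apply Real.sqrt_le_iff.2 ⟨(Real.cosh_pos b).le, ?_⟩
  have h1 := Real.cosh_sq b
  have h2 := Real.sin_sq_add_cos_sq a
  rw [mul_pow, mul_pow]
  nlinarith [sq_nonneg (Real.cos a), sq_nonneg (Real.sin a), sq_nonneg (Real.sinh b)]

theorem b_exp_taylor (w : ℂ) (hw : ‖w‖ ≤ 1) :
    ‖Complex.exp w - (1 + w + w^2/2 + w^3/6)‖ ≤ ‖w‖^4 * (5/96) ∧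
    ‖Complex.exp w - (1 + w + w^2/2)‖ ≤ ‖w‖^3 * (2/9) ∧
    ‖Complex.exp w - (1 + w)‖ ≤ ‖w‖^2 * (3/4) ∧
    ‖Complex.exp w - 1‖ ≤ ‖w‖ * 2 := by
  have h4 := Complex.exp_bound hw (n := 4) (by norm_num)
  have h3 := Complex.exp_bound hw (n := 3) (by norm_num)
  have h2 := Complex.exp_bound hw (n := 2) (by norm_num)
  have h1 := Complex.exp_bound hw (n := 1) (by norm_num)
  simp [Finset.sum_range_succ, Nat.factorial] at h4 h3 h2 h1
  norm_num at h4 h3 h2 h1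
  exact ⟨h4, h3, h2, h1⟩

theorem b_sincos_taylor (z : ℂ) (hz : ‖z‖ ≤ 1) :
    ‖Complex.sin z - (z - z^3/6)‖ ≤ ‖z‖^4 * (5/96) ∧
    ‖Complex.cos z - (1 - z^2/2)‖ ≤ ‖z‖^4 * (5/96) ∧
    ‖Complex.sin z - z‖ ≤ ‖z‖^3 * (2/9) ∧
    ‖Complex.cos z - 1‖ ≤ ‖z‖^2 * (3/4) ∧ ‖Complex.sin z‖ ≤ ‖z‖ * 2 := by
  obtain ⟨p4, p3, p2, p1⟩ := b_exp_taylor (z * Complex.I) (by simpa using hz)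
  obtain ⟨m4, m3, m2, m1⟩ := b_exp_taylor (-z * Complex.I) (by simpa using hz)
  simp only [norm_mul, Complex.norm_I, mul_one, norm_neg] at p4 p3 p2 p1 m4 m3 m2 m1
  have hI2 : Complex.I^2 = -1 := Complex.I_sq
  have hI3 : Complex.I^3 = -Complex.I := Complex.I_pow_three
  have half : ∀ A B : ℂ, ∀ c : ℝ, ‖A‖ ≤ c → ‖B‖ ≤ c →
      ‖(A + B)/2‖ ≤ c ∧ ‖(B - A) * Complex.I / 2‖ ≤ c := by
    intro A B c hA hB
    have h1 := norm_add_le A B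
    have h2 := norm_sub_le B A
    constructor
    · rw [norm_div]; simp only [Complex.norm_ofNat]; linarith
    · rw [norm_div, norm_mul]; simp only [Complex.norm_I, Complex.norm_ofNat]; linarith
  have hsin : Complex.sin z = (Complex.exp (-z * Complex.I) - Complex.exp (z * Complex.I)) * Complex.I / 2 := rfl
  have hcos : Complex.cos z = (Complex.exp (z * Complex.I) + Complex.exp (-z * Complex.I)) / 2 := rfl
  refine ⟨?_, ?_, ?_, ?_, ?_⟩
  · convert (half _ _ _ p4 m4).2 using 2
    rw [hsin]; ring_nf; simp only [hI2, Complex.I_pow_four]; ring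
  · convert (half _ _ _ p4 m4).1 using 2
    rw [hcos]; ring_nf; simp only [hI2]; ring
  · convert (half _ _ _ p3 m3).2 using 2
    rw [hsin]; ring_nf; simp only [hI2]; ring
  · convert (half _ _ _ p2 m2).1 using 2
    rw [hcos]; ring_nf
  · convert (half _ _ _ p1 m1).2 using 2
    rw [hsin]; ring_nf

theorem b_diag_taylor (β s : ℝ) (hs : |s| ≤ 1/10) :
    ‖bG β (β + (s:ℂ) * (1 - Complex.I)) - bG β β + Real.sin β * s^2‖ ≤ |s|^3 ∧
    ‖bG β (β + (s:ℂ) * (1 - Complex.I)) - bG β β + Real.sin β * s^2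
        + Complex.I * Real.cos β * ((s:ℂ) * (1 - Complex.I))^3 / 6‖ ≤ |s|^4 ∧
    ‖Complex.sin (β + (s:ℂ) * (1 - Complex.I)) - Real.sin β‖ ≤ 4 * |s| ∧
    ‖Complex.sin (β + (s:ℂ) * (1 - Complex.I)) - Real.sin β
        - Real.cos β * ((s:ℂ) * (1 - Complex.I))‖ ≤ 2 * |s|^2 := by
  set z : ℂ := (s:ℂ) * (1 - Complex.I) with hz
  have hI2 : Complex.I^2 = -1 := Complex.I_sq
  have hz2 : z^2 = -2 * Complex.I * s^2 := by
    rw [hz, mul_pow, sub_sq, hI2]; ring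
  have hn2 : ‖z‖^2 = 2 * |s|^2 := by
    rw [← norm_pow, hz2]; simp
  have h0 : 0 ≤ ‖z‖ := norm_nonneg z
  have hs0 : 0 ≤ |s| := abs_nonneg s
  have hn1 : ‖z‖ ≤ 3/2 * |s| := by
    refine abs_le_of_sq_le_sq' ?_ (by positivity) |>.2
    rw [hn2]; nlinarith
  have hn3 : ‖z‖^3 ≤ 3 * |s|^3 := by
    calc ‖z‖^3 = ‖z‖^2 * ‖z‖ := by ring
      _ ≤ (2 * |s|^2) * (3/2 * |s|) := by rw [hn2]; gcongr
      _ = _ := by ring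
  have hn4 : ‖z‖^4 = 4 * |s|^4 := by
    calc ‖z‖^4 = (‖z‖^2)^2 := by ring
      _ = _ := by rw [hn2]; ring
  have hs4 : |s|^4 ≤ |s|^3 * (1/10) := by
    calc |s|^4 = |s|^3 * |s| := by ring
      _ ≤ _ := by gcongr
  have hs3 : |s|^3 ≤ |s|^2 * (1/10) := by
    calc |s|^3 = |s|^2 * |s| := by ring
      _ ≤ _ := by gcongr
  have hs2 : |s|^2 ≤ |s| * (1/10) := by
    calc |s|^2 = |s| * |s| := by ring
      _ ≤ _ := by gcongr
  obtain ⟨t1, t2, t3, t4, t5⟩ := b_sincos_taylor z (by linarith)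
  have comb : ∀ A B : ℂ, ‖(Real.sin β:ℂ) * A + (Real.cos β:ℂ) * B‖ ≤ ‖A‖ + ‖B‖ := by
    intro A B
    refine (norm_add_le _ _).trans ?_
    rw [norm_mul, norm_mul, Complex.norm_real, Complex.norm_real]
    have a1 := Real.abs_sin_le_one β
    have a2 := Real.abs_cos_le_one β
    rw [← Real.norm_eq_abs] at a1 a2
    nlinarith [norm_nonneg A, norm_nonneg B]
  have hsinb : Complex.sin (β + z) = Real.sin β * Complex.cos z + Real.cos β * Complex.sin z := by
    rw [Complex.sin_add]; simp
  have hG : bG β (β + z) - bG β β + Real.sin β * s^2 =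
     Complex.I * ((Real.sin β:ℂ) * (Complex.cos z - (1 - z^2/2))
      + (Real.cos β:ℂ) * (Complex.sin z - z)) := by
    unfold bG
    rw [hsinb, hz2]
    have : Complex.sin (β:ℂ) = (Real.sin β : ℝ) := by simp
    rw [this]
    ring_nf
    rw [hI2]; ring
  refine ⟨?_, ?_, ?_, ?_⟩
  · rw [hG, norm_mul, Complex.norm_I, one_mul]
    refine (comb _ _).trans ?_
    linarith [pow_nonneg hs0 3]
  · have : bG β (β + z) - bG β β + Real.sin β * s^2 + Complex.I * Real.cos β * z^3 / 6 =
     Complex.I * ((Real.sin β:ℂ) * (Complex.cos z - (1 - z^2/2))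
      + (Real.cos β:ℂ) * (Complex.sin z - (z - z^3/6))) := by
      rw [hG]; ring
    rw [this, norm_mul, Complex.norm_I, one_mul]
    refine (comb _ _).trans ?_
    linarith [pow_nonneg hs0 4]
  · have : Complex.sin (β + z) - Real.sin β = (Real.sin β:ℂ) * (Complex.cos z - 1)
      + (Real.cos β:ℂ) * (Complex.sin z) := by rw [hsinb]; ring
    rw [this]
    refine (comb _ _).trans ?_
    linarith
  · have : Complex.sin (β + z) - Real.sin β - Real.cos β * z = (Real.sin β:ℂ) * (Complex.cos z - 1)
      + (Real.cos β:ℂ) * (Complex.sin z - z) := by rw [hsinb]; ring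
    rw [this]
    refine (comb _ _).trans ?_
    linarith [pow_nonneg hs0 2]

theorem b_re_G_real (β a : ℝ) : (bG β a).re = 0 := by
  have := b_re_G β a 0
  simpa using this

theorem b_diag_re (β s s0 : ℝ) (hs0 : 0 < s0) (hs1 : s0 ≤ 1) (hβ : s0 ≤ Real.sin β)
    (hs : |s| ≤ s0/10) :
    (bG β (β + (s:ℂ) * (1 - Complex.I))).re ≤ -(9/10 * s0 * s^2) := by
  obtain ⟨h1, -⟩ := b_diag_taylor β s (by linarith)
  have h2 := (Complex.re_le_norm _).trans h1
  have h3 : (((Real.sin β:ℝ):ℂ) * (s:ℂ)^2).re = Real.sin β * s^2 := by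
    rw [← Complex.ofReal_pow, ← Complex.ofReal_mul, Complex.ofReal_re]
  rw [Complex.add_re, Complex.sub_re, b_re_G_real, h3] at h2
  have h4 : |s|^3 ≤ s0/10 * s^2 := by
    calc |s|^3 = |s| * |s|^2 := by ring
      _ ≤ s0/10 * |s|^2 := by gcongr
      _ = _ := by rw [sq_abs]
  nlinarith [sq_nonneg s]

theorem b_poly_exp (a v : ℝ) (ha : 0 < a) (ha1 : a ≤ 1) (hv : 0 ≤ v) :
    2 * v + 5 * v^2 + v^3 ≤ 18 / a^3 * Real.exp (a * v) ∧ v ≤ 1 / a * Real.exp (a * v) := by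
  have hx : 0 ≤ a * v := by positivity
  have e1 := Real.pow_div_factorial_le_exp (a*v) hx 1
  have e2 := Real.pow_div_factorial_le_exp (a*v) hx 2
  have e3 := Real.pow_div_factorial_le_exp (a*v) hx 3
  simp [Nat.factorial] at e1 e2 e3
  set Ex := Real.exp (a*v)
  have hE : 0 < Ex := Real.exp_pos _
  have a2 : a^2 ≤ 1 := by nlinarith
  constructor
  · rw [div_mul_eq_mul_div, le_div_iff₀ (by positivity)]
    have h1 : v * a^3 ≤ Ex := by
      calc v * a^3 = (a*v) * a^2 := by ring
        _ ≤ (a*v) * 1 := by gcongr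
        _ ≤ _ := by linarith
    have h2 : v^2 * a^3 ≤ 2*Ex := by
      calc v^2 * a^3 = (a*v)^2 * a := by ring
        _ ≤ (a*v)^2 * 1 := by gcongr
        _ ≤ _ := by linarith
    have h3 : v^3 * a^3 ≤ 6*Ex := by
      calc v^3 * a^3 = (a*v)^3 := by ring
        _ ≤ _ := by linarith
    linarith
  · rw [div_mul_eq_mul_div, le_div_iff₀ (by positivity)]
    linarith

theorem b_diag_pt (β s s0 x : ℝ) (hs0 : 0 < s0) (hs1 : s0 ≤ 1) (hβ : s0 ≤ Real.sin β)
    (hs : |s| ≤ s0/10) (hx : 0 < x) :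
    ‖Complex.sin (β + (s:ℂ) * (1 - Complex.I)) * Complex.exp (x * bG β (β + (s:ℂ) * (1 - Complex.I)))
      - Complex.exp (x * bG β β) * ((Real.exp (-(x * Real.sin β) * s^2) : ℝ) : ℂ)
        * (Real.sin β + (Real.cos β * ((s:ℂ) * (1 - Complex.I))
          - Real.sin β * x * (Complex.I * Real.cos β * ((s:ℂ) * (1 - Complex.I))^3 / 6)))‖
    ≤ 144 / s0^3 / x * Real.exp (-(x * s0/4) * s^2) := by
  obtain ⟨h1, h2, h3, h4⟩ := b_diag_taylor β s (by linarith)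
  set z : ℂ := (s:ℂ) * (1 - Complex.I) with hz
  set E : ℂ := bG β (β + z) - bG β β + Real.sin β * s^2 with hE
  set A : ℂ := Complex.sin (β + z) with hA
  set c : ℂ := Complex.I * Real.cos β * z^3 / 6 with hc
  have hx0 := hx.le
  have hexp : Complex.exp (x * bG β (β + z)) = Complex.exp (x * bG β β) *
      ((Real.exp (-(x * Real.sin β) * s^2) : ℝ) : ℂ) * Complex.exp (x * E) := by
    rw [Complex.ofReal_exp, ← Complex.exp_add, ← Complex.exp_add, hE]
    congr 1; push_cast; ring
  have hfac : A * Complex.exp (x * bG β (β + z))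
      - Complex.exp (x * bG β β) * ((Real.exp (-(x * Real.sin β) * s^2) : ℝ) : ℂ)
        * (Real.sin β + (Real.cos β * z - Real.sin β * x * c)) =
      Complex.exp (x * bG β β) * ((Real.exp (-(x * Real.sin β) * s^2) : ℝ) : ℂ) *
      ((A - Real.sin β) * (Complex.exp (x * E) - 1) + (A - Real.sin β - Real.cos β * z)
        + Real.sin β * (Complex.exp (x * E) - 1 - x * E) + Real.sin β * (x * (E + c))) := by
    rw [hexp]; ring
  rw [hfac, norm_mul, norm_mul, Complex.norm_exp, Complex.re_ofReal_mul, b_re_G_real, mul_zero,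
    Real.exp_zero, one_mul, Complex.norm_real, Real.norm_of_nonneg (Real.exp_pos _).le]
  have hsb : ‖(Real.sin β:ℂ)‖ ≤ 1 := by
    rw [Complex.norm_real]; exact Real.abs_sin_le_one β
  have ha0 := abs_nonneg s
  have hyn : ‖(x:ℂ) * E‖ ≤ x * |s|^3 := by
    rw [norm_mul, Complex.norm_real, Real.norm_of_nonneg hx0]; gcongr
  have hyn2 : ‖(x:ℂ) * E‖ ≤ s0/10 * (x * s^2) := by
    refine hyn.trans ?_
    calc x * |s|^3 = |s| * (x * |s|^2) := by ring
      _ ≤ s0/10 * (x * |s|^2) := by gcongr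
      _ = _ := by rw [sq_abs]
  set Y := Real.exp (s0/10 * (x * s^2)) with hY
  have hY1 : 1 ≤ Y := Real.one_le_exp (by positivity)
  have b1 : ‖Complex.exp (x * E) - 1‖ ≤ x * |s|^3 * Y := by
    have := Complex.norm_exp_sub_sum_le_norm_mul_exp (x*E) 1
    simp only [Finset.sum_range_one, pow_zero, Nat.factorial, Nat.cast_one, div_one, pow_one] at this
    refine this.trans ?_
    have hEY := Real.exp_le_exp.2 hyn2
    rw [← hY] at hEY
    gcongr
  have b2 : ‖Complex.exp (x * E) - 1 - x * E‖ ≤ (x * |s|^3)^2 * Y := by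
    have := Complex.norm_exp_sub_sum_le_norm_mul_exp (x*E) 2
    simp only [Finset.sum_range_succ, Finset.sum_range_zero, zero_add, pow_zero, pow_one, Nat.factorial,
      Nat.cast_one, div_one, mul_one] at this
    rw [sub_sub]
    refine this.trans ?_
    have hEY := Real.exp_le_exp.2 hyn2
    rw [← hY] at hEY
    gcongr
  have b3 : ‖(x:ℂ) * (E + c)‖ ≤ x * |s|^4 := by
    rw [norm_mul, Complex.norm_real, Real.norm_of_nonneg hx0]; gcongr
  have tot : ‖(A - Real.sin β) * (Complex.exp (x * E) - 1) + (A - Real.sin β - Real.cos β * z)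
        + Real.sin β * (Complex.exp (x * E) - 1 - x * E) + Real.sin β * (x * (E + c))‖ ≤
      (2 * |s|^2 + 5 * x * |s|^4 + x^2 * |s|^6) * Y := by
    calc _ ≤ ‖A - Real.sin β‖ * ‖Complex.exp (x * E) - 1‖ + ‖A - Real.sin β - Real.cos β * z‖
        + ‖(Real.sin β:ℂ)‖ * ‖Complex.exp (x * E) - 1 - x * E‖ + ‖(Real.sin β:ℂ)‖ * ‖x * (E + c)‖ := by
          rw [← norm_mul, ← norm_mul, ← norm_mul]
          exact norm_add₄_le
      _ ≤ 4 * |s| * (x * |s|^3 * Y) + 2 * |s|^2 * Y + 1 * ((x * |s|^3)^2 * Y) + 1 * (x * |s|^4 * Y) := by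
          gcongr
          · exact h4.trans (le_mul_of_one_le_right (by positivity) hY1)
          · exact b3.trans (le_mul_of_one_le_right (by positivity) hY1)
      _ = _ := by ring
  obtain ⟨hp, -⟩ := b_poly_exp (s0/2) (x * s^2) (by positivity) (by linarith) (by positivity)
  have hp' : 2 * |s|^2 + 5 * x * |s|^4 + x^2 * |s|^6 ≤ 144 / s0^3 / x * Real.exp (s0/2 * (x*s^2)) := by
    have e : 2 * |s|^2 + 5 * x * |s|^4 + x^2 * |s|^6 = (2 * (x*s^2) + 5 * (x*s^2)^2 + (x*s^2)^3)/x := by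
      have e2 : |s|^2 = s^2 := sq_abs s
      have e4 : |s|^4 = s^4 := by
        calc |s|^4 = (|s|^2)^2 := by ring
          _ = _ := by rw [e2]; ring
      have e6 : |s|^6 = s^6 := by
        calc |s|^6 = (|s|^2)^3 := by ring
          _ = _ := by rw [e2]; ring
      rw [e2, e4, e6]; field_simp
    rw [e, div_le_iff₀ hx]
    refine hp.trans (le_of_eq ?_)
    field_simp; norm_num
  calc _ ≤ Real.exp (-(x * Real.sin β) * s^2) *
        (144 / s0^3 / x * Real.exp (s0/2 * (x*s^2)) * Y) := by
        gcongr
        exact tot.trans (by gcongr)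
    _ = 144 / s0^3 / x * (Real.exp (-(x * Real.sin β) * s^2) * Real.exp (s0/2 * (x*s^2)) * Y) := by ring
    _ ≤ _ := by
      rw [hY, ← Real.exp_add, ← Real.exp_add]
      gcongr
      have : 0 ≤ x * s^2 := by positivity
      nlinarith

theorem b_gauss_tail (b s0 x : ℝ) (hs0 : 0 < s0) (hs1 : s0 ≤ 1) (hb : s0 ≤ b) (hx : 0 < x) :
    |(∫ s in (-(s0/10))..(s0/10), Real.exp (-(x * b) * s^2)) - √(π / (x * b))| ≤
      200 / s0^3 / x * √(π / (x * s0/4)) := by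
  have hbp : 0 < x * b := by have : 0 < b := by linarith
                             positivity
  have hint := integrable_exp_neg_mul_sq hbp
  have hint2 := integrable_exp_neg_mul_sq (b := x * s0/4) (by positivity)
  rw [← integral_gaussian (x*b), ← integral_gaussian (x*s0/4), intervalIntegral.integral_of_le (by linarith),
    ← integral_add_compl (s := Set.Ioc (-(s0/10)) (s0/10)) measurableSet_Ioc hint, ← integral_const_mul]
  rw [abs_sub_comm, add_sub_cancel_left, abs_of_nonneg (integral_nonneg fun s => (Real.exp_pos _).le)]
  have hI3 : Integrable (fun s : ℝ => 200 / s0^3 / x * Real.exp (-(x * s0/4) * s^2)) := hint2.const_mul _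
  refine le_trans ?_ (setIntegral_le_integral (s := (Set.Ioc (-(s0/10)) (s0/10))ᶜ) hI3
    (Filter.Eventually.of_forall fun s => by positivity))
  apply setIntegral_mono_on hint.integrableOn hI3.integrableOn measurableSet_Ioc.compl
  intro s hs
  have hs2 : (s0/10)^2 ≤ s^2 := by
    by_contra hcon
    apply hs
    have := abs_lt_of_sq_lt_sq (not_le.1 hcon) (by positivity)
    rw [abs_lt] at this
    exact ⟨this.1, this.2.le⟩
  obtain ⟨-, hp⟩ := b_poly_exp (s0/2) (x * s^2) (by positivity) (by linarith) (by positivity)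
  have h1 : 1 ≤ 200 / s0^3 / x * Real.exp (s0/2 * (x*s^2)) := by
    have : x * (s0/10)^2 ≤ 1 / (s0/2) * Real.exp (s0/2 * (x*s^2)) := le_trans (by gcongr) hp
    calc 1 = 100 / s0^2 / x * (x * (s0/10)^2) := by field_simp; norm_num
      _ ≤ 100 / s0^2 / x * (1 / (s0/2) * Real.exp (s0/2 * (x*s^2))) := by gcongr
      _ = _ := by field_simp; norm_num
  calc Real.exp (-(x * b) * s^2) ≤ Real.exp (-(x * b) * s^2) * (200 / s0^3 / x * Real.exp (s0/2 * (x*s^2))) :=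
        le_mul_of_one_le_right (Real.exp_pos _).le h1
    _ = 200 / s0^3 / x * (Real.exp (-(x * b) * s^2) * Real.exp (s0/2 * (x*s^2))) := by ring
    _ ≤ _ := by
      rw [← Real.exp_add]
      gcongr
      have : 0 ≤ x * s^2 := by positivity
      nlinarith

theorem b_cont_G (β : ℝ) : Continuous (bG β) := by unfold bG; fun_prop

theorem b_diff_G (β : ℝ) : Differentiable ℂ (bG β) := by unfold bG; fun_prop

theorem b_int_gauss_le (b δ : ℝ) (hb : 0 < b) (hδ : 0 ≤ δ) :
    ∫ s in (-δ)..δ, Real.exp (-b * s^2) ≤ √(π / b) := by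
  rw [← integral_gaussian b, intervalIntegral.integral_of_le (by linarith)]
  exact setIntegral_le_integral (integrable_exp_neg_mul_sq hb)
    (Filter.Eventually.of_forall fun s => by positivity)

theorem b_odd_int (f : ℝ → ℂ) (hf : ∀ s, f (-s) = - f s) (δ : ℝ) : ∫ s in (-δ)..δ, f s = 0 := by
  have h := intervalIntegral.integral_comp_neg (a := -δ) (b := δ) f
  simp only [hf, neg_neg, intervalIntegral.integral_neg] at h
  have h2 : (2:ℂ) * ∫ s in (-δ)..δ, f s = 0 := by linear_combination -h
  simpa using h2

theorem b_diag_int (β s0 x : ℝ) (hs0 : 0 < s0) (hs1 : s0 ≤ 1) (hβ : s0 ≤ Real.sin β)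
    (hx : 0 < x) :
    ‖(∫ s in (-(s0/10))..(s0/10), Complex.sin (β + (s:ℂ) * (1 - Complex.I)) *
        Complex.exp (x * bG β (β + (s:ℂ) * (1 - Complex.I))))
      - Complex.exp (x * bG β β) * ((Real.sin β * √(π / (x * Real.sin β)) : ℝ) : ℂ)‖
    ≤ 344 / s0^3 / x * √(π / (x * s0/4)) := by
  have hG := b_cont_G β
  set C := Complex.exp (x * bG β β) with hC
  have hCn : ‖C‖ = 1 := by
    rw [hC, Complex.norm_exp, Complex.re_ofReal_mul, b_re_G_real, mul_zero, Real.exp_zero]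
  set F : ℝ → ℂ := fun s => Complex.sin (β + (s:ℂ) * (1 - Complex.I)) *
        Complex.exp (x * bG β (β + (s:ℂ) * (1 - Complex.I))) with hF
  set o : ℝ → ℂ := fun s => ((Real.exp (-(x * Real.sin β) * s^2) : ℝ) : ℂ) *
     (Real.cos β * ((s:ℂ) * (1 - Complex.I))
          - Real.sin β * x * (Complex.I * Real.cos β * ((s:ℂ) * (1 - Complex.I))^3 / 6)) with ho
  set e : ℝ → ℂ := fun s => ((Real.exp (-(x * Real.sin β) * s^2) : ℝ) : ℂ) with he
  have cF : Continuous F := by rw [hF]; fun_prop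
  have co : Continuous o := by rw [ho]; fun_prop
  have ce : Continuous e := by rw [he]; fun_prop
  have ho0 : ∫ s in (-(s0/10))..(s0/10), o s = 0 := by
    apply b_odd_int
    intro s
    simp only [ho]
    push_cast
    ring_nf
  have h1 : ∫ s in (-(s0/10))..(s0/10), (F s - C * (e s * Real.sin β + o s)) =
      (∫ s in (-(s0/10))..(s0/10), F s) -
        C * (((∫ s in (-(s0/10))..(s0/10), Real.exp (-(x * Real.sin β) * s^2) : ℝ) : ℂ) * Real.sin β) := by
    rw [intervalIntegral.integral_sub (cF.intervalIntegrable _ _)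
      ((by fun_prop : Continuous fun s => C * (e s * Real.sin β + o s)).intervalIntegrable _ _),
      intervalIntegral.integral_const_mul, intervalIntegral.integral_add
      ((by fun_prop : Continuous fun s => (e s * Real.sin β)).intervalIntegrable _ _)
      (co.intervalIntegrable _ _), ho0, add_zero, intervalIntegral.integral_mul_const]
    congr 3
    exact intervalIntegral.integral_ofReal
  have h2 : ‖∫ s in (-(s0/10))..(s0/10), (F s - C * (e s * Real.sin β + o s))‖ ≤
      144 / s0^3 / x * √(π / (x * s0/4)) := by
    have := intervalIntegral.norm_integral_le_of_norm_le (a := -(s0/10)) (b := s0/10) (μ := volume)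
      (f := fun s => (F s - C * (e s * Real.sin β + o s)))
      (g := fun s => 144 / s0^3 / x * Real.exp (-(x * s0/4) * s^2)) (by linarith)
      (Filter.Eventually.of_forall fun s hs => ?_)
      ((by fun_prop : Continuous _).intervalIntegrable _ _)
    · refine this.trans ?_
      rw [intervalIntegral.integral_const_mul]
      gcongr
      exact b_int_gauss_le _ _ (by positivity) (by positivity)
    · have := b_diag_pt β s s0 x hs0 hs1 hβ (by rw [abs_le]; exact ⟨hs.1.le, hs.2⟩) hx
      refine le_of_eq_of_le (congrArg norm ?_) this
      dsimp only [F, e, o]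
      ring
  have h3 := b_gauss_tail (Real.sin β) s0 x hs0 hs1 hβ hx
  set Gi := ∫ s in (-(s0/10))..(s0/10), Real.exp (-(x * Real.sin β) * s^2)
  have h4 : (∫ s in (-(s0/10))..(s0/10), F s) -
      C * ((Real.sin β * √(π / (x * Real.sin β)) : ℝ) : ℂ) =
      (∫ s in (-(s0/10))..(s0/10), (F s - C * (e s * Real.sin β + o s))) +
      C * ((Real.sin β * (Gi - √(π / (x * Real.sin β))) : ℝ) : ℂ) := by
    rw [h1]; push_cast; ring
  rw [h4]
  refine (norm_add_le _ _).trans ?_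
  rw [norm_mul, hCn, one_mul, Complex.norm_real, Real.norm_eq_abs, abs_mul]
  have h5 : |Real.sin β| * |Gi - √(π / (x * Real.sin β))| ≤ 1 * (200 / s0^3 / x * √(π / (x * s0/4))) := by
    gcongr
    exact Real.abs_sin_le_one β
  calc _ ≤ 144 / s0^3 / x * √(π / (x * s0/4)) + 1 * (200 / s0^3 / x * √(π / (x * s0/4))) :=
        add_le_add h2 h5
    _ = _ := by ring

theorem b_int_exp (c δ : ℝ) (hc : 0 < c) : ∫ s in (0:ℝ)..δ, Real.exp (-(c * s)) ≤ 1 / c := by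
  have : ∫ s in (0:ℝ)..δ, Real.exp (-(c * s)) = (1 - Real.exp (-(c*δ))) / c := by
    rw [intervalIntegral.integral_eq_sub_of_hasDerivAt (f := fun s => - Real.exp (-(c*s)) / c)]
    · simp; ring
    · intro s _
      have h : HasDerivAt (fun s => -(c*s)) (-(c*1)) s := ((hasDerivAt_id s).const_mul c).neg
      have h2 := h.exp.neg.div_const c
      have e : -(Real.exp (-(c*s)) * -(c*1)) / c = Real.exp (-(c*s)) := by field_simp
      rw [e] at h2
      exact h2
    · exact (by fun_prop : Continuous _).intervalIntegrable _ _
  rw [this]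
  gcongr
  linarith [Real.exp_pos (-(c*δ))]

theorem b_rest (A : ℂ → ℂ) (hA : Differentiable ℂ A) (β s0 x W : ℝ) (hs0 : 0 < s0) (hs1 : s0 ≤ 1)
    (hβ : s0 ≤ Real.sin β) (hβ0 : 0 ≤ β) (hβ2 : β ≤ π/2) (hx : 0 < x) (hW : 0 ≤ W)
    (hA2 : ∀ a b : ℝ, |b| ≤ 1 → ‖A (a + b * Complex.I)‖ ≤ 2)
    (hW1 : ∀ s : ℝ, 0 ≤ s → s ≤ 1 →
      ‖A (0 + s * Complex.I)‖ * Real.exp (-(s0^2/2 * x * s)) ≤ W * Real.exp (-(s0^2/4 * x * s)))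
    (hW2 : ∀ s : ℝ, 0 ≤ s → s ≤ 1 →
      ‖A (π + s * (-Complex.I))‖ * Real.exp (-(s0^2/2 * x * s)) ≤ W * Real.exp (-(s0^2/4 * x * s))) :
    ‖(∫ t in (0:ℝ)..π, A t * Complex.exp (x * bG β t)) -
      (∫ s in (-(s0/10))..(s0/10), A (β + (s:ℂ) * (1 - Complex.I)) *
        Complex.exp (x * bG β (β + (s:ℂ) * (1 - Complex.I)))) * (1 - Complex.I)‖ ≤
      8 * W / (s0^2 * x) + 16 * Real.exp (-(9/1000 * s0^3 * x)) := by
  have hGd := b_diff_G β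
  have hpi := Real.pi_le_four
  have hpi3 := Real.pi_gt_three
  have hδβ : s0/10 ≤ β := by
    have := Real.sin_le hβ0
    linarith
  have hcos0 : 0 ≤ Real.cos β := Real.cos_nonneg_of_mem_Icc ⟨by linarith, hβ2⟩
  have hcos1 := Real.cos_le_one β
  have hκ : s0^2/2 ≤ 1 - Real.cos β := by
    have := Real.sin_sq_add_cos_sq β
    nlinarith
  set f : ℂ → ℂ := fun t => A t * Complex.exp (x * bG β t) with hf
  have hfd : Differentiable ℂ f := by rw [hf]; fun_prop
  have hfn : ∀ t, ‖f t‖ = ‖A t‖ * Real.exp (x * (bG β t).re) := by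
    intro t
    simp only [hf]
    rw [norm_mul, Complex.norm_exp, Complex.re_ofReal_mul]
  have hct := b_contour hfd β (s0/10) hβ0 hβ2 (by positivity) (by linarith) hδβ
  rw [intervalIntegral.integral_mul_const (μ := volume) (a := -(s0/10)) (b := s0/10)] at hct
  simp only [mul_one] at hct
  -- vertical pieces
  have hV : ∀ g : ℝ → ℂ, (∀ s : ℝ, 0 ≤ s → s ≤ 1 → ‖g s‖ ≤ W * Real.exp (-(s0^2/4 * x * s))) →
      ‖∫ s in (0:ℝ)..(s0/10), g s‖ ≤ 4 * W / (s0^2 * x) := by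
    intro g hg
    have := intervalIntegral.norm_integral_le_of_norm_le (a := 0) (b := s0/10) (μ := volume)
      (f := g) (g := fun s => W * Real.exp (-(s0^2/4 * x * s))) (by linarith)
      (Filter.Eventually.of_forall fun s hs => hg s hs.1.le (by linarith [hs.2]))
      ((by fun_prop : Continuous _).intervalIntegrable _ _)
    refine this.trans ?_
    rw [intervalIntegral.integral_const_mul]
    calc W * _ ≤ W * (1 / (s0^2/4*x)) := by
          gcongr
          exact b_int_exp _ _ (by positivity)
      _ = _ := by field_simp
  have hV1 : ‖∫ s in (0:ℝ)..(s0/10), f (0 + (s:ℂ) * Complex.I) * Complex.I‖ ≤ 4 * W / (s0^2 * x) := by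
    apply hV
    intro s h0 h1
    rw [norm_mul, Complex.norm_I, mul_one, hfn]
    refine le_trans ?_ (hW1 s h0 h1)
    gcongr
    have := b_re_G β 0 s
    rw [Complex.ofReal_zero] at this
    rw [this, Real.cos_zero, one_mul]
    have h2 := Real.self_le_sinh_iff.2 h0
    have h3 : s0^2/2 * s ≤ Real.sinh s - s * Real.cos β := by nlinarith
    nlinarith
  have hV2 : ‖∫ s in (0:ℝ)..(s0/10), f (π + (s:ℂ) * (-Complex.I)) * (-Complex.I)‖ ≤ 4 * W / (s0^2 * x) := by
    apply hV
    intro s h0 h1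
    rw [norm_mul, norm_neg, Complex.norm_I, mul_one, hfn]
    refine le_trans ?_ (hW2 s h0 h1)
    gcongr
    have := b_re_G β π (-s)
    rw [Complex.ofReal_neg, neg_mul_comm] at this
    rw [this, Real.cos_pi, Real.sinh_neg]
    have h2 := Real.self_le_sinh_iff.2 h0
    have h3 : s0^2/2 * s ≤ Real.sinh s + s * Real.cos β := by nlinarith
    nlinarith
  have hsh : 0 ≤ Real.sinh (s0/10) := Real.sinh_nonneg_iff.2 (by positivity)
  have hL : -(Real.cos (β - s0/10) * Real.sinh (s0/10) - s0/10 * Real.cos β) ≤ -(9/1000 * s0^3) := by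
    have h1 := b_diag_re β (-(s0/10)) s0 hs0 hs1 hβ (by rw [abs_neg, abs_of_pos (by positivity)])
    have h2 := b_re_G β (β - s0/10) (s0/10)
    rw [← h2]
    have e : ((β - s0/10 : ℝ):ℂ) + ((s0/10:ℝ):ℂ) * Complex.I =
      (β:ℂ) + ((-(s0/10) : ℝ):ℂ) * (1 - Complex.I) := by push_cast; ring
    rw [e]
    refine h1.trans (le_of_eq (by ring))
  have hR : Real.cos (β + s0/10) * Real.sinh (s0/10) - s0/10 * Real.cos β ≤ -(9/1000 * s0^3) := by
    have h1 := b_diag_re β (s0/10) s0 hs0 hs1 hβ (by rw [abs_of_pos (by positivity)])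
    have h2 := b_re_G β (β + s0/10) (-(s0/10))
    rw [Real.sinh_neg] at h2
    have e : ((β + s0/10 : ℝ):ℂ) + ((-(s0/10):ℝ):ℂ) * Complex.I =
      (β:ℂ) + ((s0/10 : ℝ):ℂ) * (1 - Complex.I) := by push_cast; ring
    rw [e] at h2
    rw [h2] at h1
    linarith [h1, (by ring : 9/10 * s0 * (s0/10)^2 = 9/1000 * s0^3)]
  have hH1 : ‖∫ s in (0:ℝ)..(β - s0/10), f ((s0/10:ℝ) * Complex.I + (s:ℂ))‖ ≤
      8 * Real.exp (-(9/1000 * s0^3 * x)) := by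
    have := intervalIntegral.norm_integral_le_of_norm_le_const (a := 0) (b := β - s0/10)
      (f := fun s : ℝ => f ((s0/10:ℝ) * Complex.I + (s:ℂ))) (C := 2 * Real.exp (-(9/1000 * s0^3 * x))) ?_
    · refine this.trans ?_
      rw [sub_zero, abs_of_nonneg (by linarith)]
      nlinarith [Real.exp_pos (-(9/1000 * s0^3 * x))]
    · intro s hs
      rw [Set.uIoc_of_le (by linarith)] at hs
      rw [hfn, add_comm]
      gcongr
      · exact hA2 _ _ (by rw [abs_of_pos (by positivity)]; linarith)
      · rw [b_re_G]
        have : Real.cos (β - s0/10) ≤ Real.cos s :=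
          Real.cos_le_cos_of_nonneg_of_le_pi hs.1.le (by linarith) hs.2
        have h3 : -(Real.cos s * Real.sinh (s0/10) - s0/10 * Real.cos β) ≤ -(9/1000 * s0^3) := by
          nlinarith
        nlinarith
  have hH2 : ‖∫ s in (β + s0/10)..π, f (-((s0/10:ℝ) * Complex.I) + (s:ℂ))‖ ≤
      8 * Real.exp (-(9/1000 * s0^3 * x)) := by
    have := intervalIntegral.norm_integral_le_of_norm_le_const (a := β + s0/10) (b := π)
      (f := fun s : ℝ => f (-((s0/10:ℝ) * Complex.I) + (s:ℂ))) (C := 2 * Real.exp (-(9/1000 * s0^3 * x))) ?_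
    · refine this.trans ?_
      rw [abs_of_nonneg (by linarith)]
      nlinarith [Real.exp_pos (-(9/1000 * s0^3 * x))]
    · intro s hs
      rw [Set.uIoc_of_le (by linarith)] at hs
      have e : -(((s0/10:ℝ):ℂ) * Complex.I) + (s:ℂ) = (s:ℂ) + ((-(s0/10):ℝ):ℂ) * Complex.I := by
        push_cast; ring
      rw [hfn, e]
      gcongr
      · exact hA2 _ _ (by rw [abs_neg, abs_of_pos (by positivity)]; linarith)
      · rw [b_re_G, Real.sinh_neg]
        have : Real.cos s ≤ Real.cos (β + s0/10) :=
          Real.cos_le_cos_of_nonneg_of_le_pi (by linarith) hs.2 hs.1.le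
        have h3 : -(Real.cos s * -Real.sinh (s0/10) - -(s0/10) * Real.cos β) ≤ -(9/1000 * s0^3) := by
          nlinarith
        nlinarith
  rw [hct]
  set V1 := ∫ s in (0:ℝ)..(s0/10), f (0 + (s:ℂ) * Complex.I) * Complex.I
  set V2 := ∫ s in (0:ℝ)..(s0/10), f (π + (s:ℂ) * (-Complex.I)) * (-Complex.I)
  set H1 := ∫ s in (0:ℝ)..(β - s0/10), f ((s0/10:ℝ) * Complex.I + (s:ℂ))
  set H2 := ∫ s in (β + s0/10)..π, f (-((s0/10:ℝ) * Complex.I) + (s:ℂ))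
  set D := (∫ s in (-(s0/10))..(s0/10), f (β + (s:ℂ) * (1 - Complex.I))) * (1 - Complex.I)
  have : V1 + H1 + D + H2 - V2 - D = V1 + H1 + H2 + (-V2) := by ring
  rw [this]
  refine norm_add₄_le.trans ?_
  rw [norm_neg]
  calc _ ≤ 4 * W / (s0^2 * x) + 8 * Real.exp (-(9/1000 * s0^3 * x)) +
        8 * Real.exp (-(9/1000 * s0^3 * x)) + 4 * W / (s0^2 * x) := by gcongr
    _ = _ := by ring

theorem b_exp_le (c x : ℝ) (hc : 0 < c) (hx : 1 ≤ x) :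
    Real.exp (-(c * x)) ≤ 2 / c^2 * (1 / (x * √x)) ∧ Real.exp (-(c * x)) ≤ 1 / c * (1 / √x) := by
  have hx0 : 0 < x := by linarith
  have hsx : √x ≤ x := by
    rw [Real.sqrt_le_left (by linarith)]; nlinarith
  have hsp : 0 < √x := Real.sqrt_pos.2 hx0
  have e1 := Real.pow_div_factorial_le_exp (c*x) (by positivity) 1
  have e2 := Real.pow_div_factorial_le_exp (c*x) (by positivity) 2
  simp [Nat.factorial] at e1 e2
  have hE := Real.exp_pos (c*x)
  rw [Real.exp_neg]
  constructor
  · calc (Real.exp (c*x))⁻¹ ≤ ((c*x)^2/2)⁻¹ := by gcongr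
      _ = 2/c^2 * (1 / (x*x)) := by field_simp
      _ ≤ _ := by gcongr
  · calc (Real.exp (c*x))⁻¹ ≤ (c*x)⁻¹ := by gcongr
      _ = 1/c * (1 / x) := by field_simp
      _ ≤ _ := by gcongr

theorem b_sin_asym (s0 : ℝ) (hs0 : 0 < s0) (hs1 : s0 ≤ 1) : ∃ K : ℝ, 0 < K ∧ ∀ β x : ℝ,
    s0 ≤ Real.sin β → 0 ≤ β → β ≤ π/2 → 1 ≤ x →
    ‖(∫ t in (0:ℝ)..π, Complex.sin t * Complex.exp (x * bG β t)) -
      Complex.exp (x * bG β β) * ((Real.sin β * √(π / (x * Real.sin β)) : ℝ) : ℂ) * (1 - Complex.I)‖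
      ≤ K * (1 / (x * √x)) := by
  refine ⟨64 / s0^4 + 16 * (2 / (9/1000*s0^3)^2) + 344 / s0^3 * √(4*π/s0) * 2, by positivity, ?_⟩
  intro β x hβ hβ0 hβ2 hx
  have hx0 : 0 < x := by linarith
  have hsp : 0 < √x := Real.sqrt_pos.2 hx0
  have hsx : √x ≤ x := by
    rw [Real.sqrt_le_left (by linarith)]; nlinarith
  have hd := b_diag_int β s0 x hs0 hs1 hβ hx0
  have hWs : ∀ s : ℝ, 0 ≤ s → s ≤ 1 → ‖Complex.sin (s * Complex.I)‖ * Real.exp (-(s0^2/2 * x * s)) ≤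
      8/(s0^2*x) * Real.exp (-(s0^2/4 * x * s)) := by
    intro s h0 h1
    have hn : ‖(s:ℂ) * Complex.I‖ = s := by simp [abs_of_nonneg h0]
    have := (b_sincos_taylor (s * Complex.I) (by rw [hn]; exact h1)).2.2.2.2
    rw [hn] at this
    have e1 := Real.add_one_le_exp (s0^2/4*x*s)
    have e3 : s * 2 ≤ 8/(s0^2*x) * Real.exp (s0^2/4*x*s) := by
      calc s * 2 = 8/(s0^2*x) * (s0^2/4*x*s) := by field_simp; ring
        _ ≤ _ := by gcongr; linarith
    calc _ ≤ (8/(s0^2*x) * Real.exp (s0^2/4*x*s)) * Real.exp (-(s0^2/2 * x * s)) := by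
          gcongr; exact this.trans e3
      _ = 8/(s0^2*x) * (Real.exp (s0^2/4*x*s) * Real.exp (-(s0^2/2 * x * s))) := by ring
      _ = _ := by
        rw [← Real.exp_add]; congr 2; ring
  have hr := b_rest Complex.sin Complex.differentiable_sin β s0 x (8/(s0^2*x)) hs0 hs1 hβ hβ0 hβ2 hx0
    (by positivity) ?_ ?_ ?_
  · have hI : ‖(1:ℂ) - Complex.I‖ ≤ 2 := by
      refine (norm_sub_le _ _).trans ?_
      simp; norm_num
    set T := ∫ t in (0:ℝ)..π, Complex.sin t * Complex.exp (x * bG β t)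
    set D := ∫ s in (-(s0/10))..(s0/10), Complex.sin (β + (s:ℂ) * (1 - Complex.I)) *
        Complex.exp (x * bG β (β + (s:ℂ) * (1 - Complex.I)))
    set M := Complex.exp (x * bG β β) * ((Real.sin β * √(π / (x * Real.sin β)) : ℝ) : ℂ)
    have e : T - M * (1 - Complex.I) = (T - D * (1 - Complex.I)) + (D - M) * (1 - Complex.I) := by ring
    rw [e]
    refine (norm_add_le _ _).trans ?_
    rw [norm_mul]
    have hex := (b_exp_le (9/1000*s0^3) x (by positivity) hx).1
    have hsq : √(π / (x * s0/4)) = √(4*π/s0) / √x := by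
      rw [← Real.sqrt_div (by positivity)]; congr 1; field_simp
    calc _ ≤ (8 * (8/(s0^2*x)) / (s0^2 * x) + 16 * (2 / (9/1000*s0^3)^2 * (1 / (x * √x)))) +
          (344 / s0^3 / x * √(π / (x * s0/4))) * 2 := by
          gcongr
          exact hr.trans (by gcongr)
      _ ≤ (64 / s0^4 * (1 / (x * √x)) + 16 * (2 / (9/1000*s0^3)^2 * (1 / (x * √x)))) +
          (344 / s0^3 * √(4*π/s0) * (1 / (x * √x))) * 2 := by
          gcongr ?_ + _ + ?_ * _
          · calc 8 * (8/(s0^2*x)) / (s0^2 * x) = 64/s0^4 * (1 / (x * x)) := by field_simp; norm_num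
              _ ≤ _ := by gcongr
          · rw [hsq]; apply le_of_eq; field_simp
      _ = _ := by ring
  · intro a b hb
    refine (b_norm_sin a b).trans ?_
    have : Real.cosh b ≤ Real.cosh 1 := by
      rw [Real.cosh_le_cosh]; simpa using hb
    refine this.trans ?_
    rw [Real.cosh_eq]
    have h1 := Real.exp_one_lt_d9
    have h2 : Real.exp (-1) ≤ 1 := by
      rw [Real.exp_le_one_iff]; norm_num
    linarith
  · intro s h0 h1
    rw [zero_add]; exact hWs s h0 h1
  · intro s h0 h1
    have : Complex.sin (π + s * (-Complex.I)) = Complex.sin (s * Complex.I) := by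
      rw [add_comm, Complex.sin_add_pi, mul_neg, Complex.sin_neg, neg_neg]
    rw [this]; exact hWs s h0 h1

theorem b_one_bound (s0 : ℝ) (hs0 : 0 < s0) (hs1 : s0 ≤ 1) : ∃ K : ℝ, 0 < K ∧ ∀ β x : ℝ,
    s0 ≤ Real.sin β → 0 ≤ β → β ≤ π/2 → 1 ≤ x →
    ‖∫ t in (0:ℝ)..π, Complex.exp (x * bG β t)‖ ≤ K * (1 / √x) := by
  refine ⟨8 / s0^2 + 16 * (1 / (9/1000*s0^3)) + √(π/(9/10*s0)) * 2, by positivity, ?_⟩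
  intro β x hβ hβ0 hβ2 hx
  have hx0 : 0 < x := by linarith
  have hsp : 0 < √x := Real.sqrt_pos.2 hx0
  have hsx : √x ≤ x := by
    rw [Real.sqrt_le_left (by linarith)]; nlinarith
  have hw : ∀ s : ℝ, 0 ≤ s → ‖(1:ℂ)‖ * Real.exp (-(s0^2/2 * x * s)) ≤ 1 * Real.exp (-(s0^2/4 * x * s)) := by
    intro s h0
    rw [norm_one, one_mul, one_mul, Real.exp_le_exp]
    have : 0 ≤ s0^2 * x * s := by positivity
    linarith
  have hr := b_rest (fun _ => 1) (differentiable_const _) β s0 x 1 hs0 hs1 hβ hβ0 hβ2 hx0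
    (by positivity) (fun a b _ => by simp) (fun s h0 _ => hw s h0) (fun s h0 _ => hw s h0)
  simp only [one_mul] at hr
  have hI : ‖(1:ℂ) - Complex.I‖ ≤ 2 := by
    refine (norm_sub_le _ _).trans ?_
    simp; norm_num
  have hD : ‖∫ s in (-(s0/10))..(s0/10), 
        Complex.exp (x * bG β (β + (s:ℂ) * (1 - Complex.I)))‖ ≤ √(π / (x * (9/10*s0))) := by
    refine le_trans ?_ (b_int_gauss_le (x * (9/10*s0)) (s0/10) (by positivity) (by positivity))
    apply intervalIntegral.norm_integral_le_of_norm_le (by linarith)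
    · refine Filter.Eventually.of_forall fun s hs => ?_
      rw [Complex.norm_exp, Complex.re_ofReal_mul]
      have := b_diag_re β s s0 hs0 hs1 hβ (by rw [abs_le]; exact ⟨hs.1.le, hs.2⟩)
      rw [Real.exp_le_exp]
      nlinarith
    · exact (by fun_prop : Continuous _).intervalIntegrable _ _
  set T := ∫ t in (0:ℝ)..π, Complex.exp (x * bG β t)
  set D := ∫ s in (-(s0/10))..(s0/10), Complex.exp (x * bG β (β + (s:ℂ) * (1 - Complex.I)))
  have e : T = (T - D * (1 - Complex.I)) + D * (1 - Complex.I) := by ring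
  rw [e]
  refine (norm_add_le _ _).trans ?_
  rw [norm_mul]
  have hex := (b_exp_le (9/1000*s0^3) x (by positivity) hx).2
  have hsq : √(π / (x * (9/10*s0))) = √(π/(9/10*s0)) / √x := by
    rw [← Real.sqrt_div (by positivity)]; congr 1; field_simp
  calc _ ≤ (8 * 1 / (s0^2 * x) + 16 * (1 / (9/1000*s0^3) * (1 / √x))) + √(π / (x * (9/10*s0))) * 2 := by
          gcongr
          exact hr.trans (by gcongr)
    _ ≤ (8 / s0^2 * (1 / √x) + 16 * (1 / (9/1000*s0^3) * (1 / √x))) + (√(π/(9/10*s0)) * (1 / √x)) * 2 := by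
          gcongr ?_ + _ + ?_ * _
          · calc 8 * 1 / (s0^2 * x) = 8/s0^2 * (1 / x) := by field_simp
              _ ≤ _ := by gcongr
          · rw [hsq]; apply le_of_eq; field_simp
    _ = _ := by ring

theorem b_exp_G_real (β x t : ℝ) : Complex.exp (x * bG β t) =
    ((Real.cos (x * Real.sin t - x * Real.cos β * t) : ℝ) : ℂ) +
     ((Real.sin (x * Real.sin t - x * Real.cos β * t) : ℝ):ℂ) * Complex.I := by
  have : (x:ℂ) * bG β t = ((x * Real.sin t - x * Real.cos β * t : ℝ) : ℂ) * Complex.I := by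
    unfold bG; push_cast; ring
  rw [this, Complex.exp_mul_I]
  push_cast; ring

theorem b_real_sin (s0 : ℝ) (hs0 : 0 < s0) (hs1 : s0 ≤ 1) : ∃ K : ℝ, 0 < K ∧ ∀ β x : ℝ,
    s0 ≤ Real.sin β → 0 ≤ β → β ≤ π/2 → 1 ≤ x →
    |(∫ t in (0:ℝ)..π, Real.sin t * Real.sin (x * Real.sin t - x * Real.cos β * t)) -
      √2 * (Real.sin β * √(π / (x * Real.sin β))) *
        Real.sin (x * Real.sin β - x * Real.cos β * β - π/4)| ≤ K * (1 / (x * √x)) := by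
  obtain ⟨K, hK, h⟩ := b_sin_asym s0 hs0 hs1
  refine ⟨K, hK, fun β x hβ hβ0 hβ2 hx => ?_⟩
  refine le_trans ?_ (h β x hβ hβ0 hβ2 hx)
  refine le_trans (le_of_eq ?_) (Complex.abs_im_le_norm _)
  congr 1
  have hG := b_cont_G β
  have h1 := Complex.imCLM.intervalIntegral_comp_comm (a := 0) (b := π) (μ := volume)
    (f := fun t : ℝ => Complex.sin t * Complex.exp (x * bG β t))
    ((by fun_prop : Continuous _).intervalIntegrable _ _)
  rw [Complex.imCLM_apply] at h1
  rw [Complex.sub_im, ← h1]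
  congr 1
  · apply intervalIntegral.integral_congr
    intro t _
    simp only [Complex.imCLM_apply]
    rw [b_exp_G_real, ← Complex.ofReal_sin]
    simp [-Complex.ofReal_sin, -Complex.ofReal_cos]
  · rw [b_exp_G_real, Real.sin_sub, Real.cos_pi_div_four, Real.sin_pi_div_four]
    have h2 : √2 * √2 = 2 := Real.mul_self_sqrt (by norm_num)
    simp [-Complex.ofReal_sin, -Complex.ofReal_cos, -Complex.ofReal_mul]
    linear_combination (Real.sin β * √(π / (x * Real.sin β)) * (Real.sin (x * Real.sin β - x * Real.cos β * β) -
      Real.cos (x * Real.sin β - x * Real.cos β * β)) / 2) * h2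

theorem b_real_cos (s0 : ℝ) (hs0 : 0 < s0) (hs1 : s0 ≤ 1) : ∃ K : ℝ, 0 < K ∧ ∀ β x : ℝ,
    s0 ≤ Real.sin β → 0 ≤ β → β ≤ π/2 → 1 ≤ x →
    |∫ t in (0:ℝ)..π, Real.cos (x * Real.sin t - x * Real.cos β * t)| ≤ K * (1 / √x) := by
  obtain ⟨K, hK, h⟩ := b_one_bound s0 hs0 hs1
  refine ⟨K, hK, fun β x hβ hβ0 hβ2 hx => ?_⟩
  refine le_trans ?_ (h β x hβ hβ0 hβ2 hx)
  refine le_trans (le_of_eq ?_) (Complex.abs_re_le_norm _)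
  congr 1
  have hG := b_cont_G β
  have h1 := Complex.reCLM.intervalIntegral_comp_comm (a := 0) (b := π) (μ := volume)
    (f := fun t : ℝ => Complex.exp (x * bG β t))
    ((by fun_prop : Continuous _).intervalIntegrable _ _)
  rw [Complex.reCLM_apply] at h1
  rw [← h1]
  apply intervalIntegral.integral_congr
  intro t _
  simp only [Complex.reCLM_apply]
  rw [b_exp_G_real]
  simp [-Complex.ofReal_sin, -Complex.ofReal_cos]

theorem b_amp (x S : ℝ) (hx : 0 < x) (hS : 0 < S) :
    (1 / π) * (√2 * (S * √(π / (x * S)))) = (2 / π) ^ ((1:ℝ)/2) * √(x * S) * x⁻¹ := by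
  rw [← Real.sqrt_eq_rpow]
  have hp := Real.pi_pos
  apply (sq_eq_sq₀ (by positivity) (by positivity)).1
  rw [mul_pow, mul_pow, mul_pow, mul_pow, mul_pow, Real.sq_sqrt (by positivity), Real.sq_sqrt (by positivity),
    Real.sq_sqrt (by positivity), Real.sq_sqrt (by positivity)]
  field_simp

/-- Fix `σ ≥ 0` and `C > 0`, and set `φ_ν(x) = J_ν′(x) + (σ/x)·J_ν(x)`. There exist
`K > 0` and `x₀ > 0` such that for all `x ≥ x₀` and all `0 ≤ ν ≤ x/(1+C)`:
`|φ_ν(x) + √(2/π)·(x²−ν²)^{1/4}·x⁻¹·sin(πx g(ν/x) − π/4)| ≤ K (x²−ν²)^{1/4} x⁻²`. -/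
theorem besselPhi_uniform_asymptotics (σ C : ℝ) (hσ : 0 ≤ σ) (hC : 0 < C) :
    ∃ K : ℝ, 0 < K ∧ ∃ x₀ : ℝ, 0 < x₀ ∧ ∀ x : ℝ, x₀ ≤ x → ∀ ν : ℝ, 0 ≤ ν →
      ν ≤ x / (1 + C) →
      |(deriv (fun y : ℝ => besselJnu ν y) x + (σ / x) * besselJnu ν x) +
          (2 / π) ^ ((1:ℝ)/2) * (x ^ 2 - ν ^ 2) ^ ((1:ℝ)/4) * x⁻¹ *
            Real.sin (π * x * gfun (ν / x) - π / 4)|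
        ≤ K * (x ^ 2 - ν ^ 2) ^ ((1:ℝ)/4) * x ^ (-(2:ℝ)) := by
  set r0 : ℝ := 1 / (1 + C) with hr0
  have hr0p : 0 < r0 := by positivity
  have hr01 : r0 < 1 := by rw [hr0, div_lt_one (by linarith)]; linarith
  set s0 : ℝ := √(1 - r0^2) with hs0d
  have hs0 : 0 < s0 := Real.sqrt_pos.2 (by nlinarith)
  have hs1 : s0 ≤ 1 := by
    rw [hs0d, Real.sqrt_le_left (by norm_num)]; nlinarith
  obtain ⟨K1, hK1, H1⟩ := b_real_sin s0 hs0 hs1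
  obtain ⟨K2, hK2, H2⟩ := b_real_cos s0 hs0 hs1
  have hpi := Real.pi_gt_three
  have hss : 0 < √s0 := Real.sqrt_pos.2 hs0
  refine ⟨(K1 + 4 + σ * (K2 + 1)) / √s0, by positivity, 1, one_pos, ?_⟩
  intro x hx ν hν hνx
  have hx0 : 0 < x := by linarith
  have hsp : 0 < √x := Real.sqrt_pos.2 hx0
  have hsx : √x ≤ x := by
    rw [Real.sqrt_le_left (by linarith)]; nlinarith
  set r : ℝ := ν / x with hr
  have hr_0 : 0 ≤ r := by positivity
  have hr_1 : r ≤ r0 := by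
    rw [hr, div_le_iff₀ hx0, hr0]; linarith [(by ring : x / (1 + C) = 1 / (1 + C) * x)]
  set β : ℝ := Real.arccos r with hβd
  have hβ0 : 0 ≤ β := Real.arccos_nonneg r
  have hβ2 : β ≤ π / 2 := Real.arccos_le_pi_div_two.2 hr_0
  have hcos : Real.cos β = r := Real.cos_arccos (by linarith) (by linarith)
  have hsin : Real.sin β = √(1 - r^2) := Real.sin_arccos r
  have hβs : s0 ≤ Real.sin β := by
    rw [hsin, hs0d]
    apply Real.sqrt_le_sqrt
    nlinarith
  have hS : 0 < Real.sin β := by linarith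
  have hxr : x * r = ν := by rw [hr]; field_simp
  have h1 := H1 β x hβs hβ0 hβ2 hx
  have h2 := H2 β x hβs hβ0 hβ2 hx
  rw [hcos, hxr] at h1 h2
  have hθ : π * x * gfun r - π / 4 = x * Real.sin β - ν * β - π / 4 := by
    unfold gfun
    rw [hsin, ← hβd, ← hxr]
    have := Real.pi_ne_zero
    field_simp
  have hquart : (x^2 - ν^2) ^ ((1:ℝ)/4) = √(x * Real.sin β) := by
    have e : x^2 - ν^2 = (x * Real.sin β)^2 := by
      rw [mul_pow, hsin, Real.sq_sqrt (by nlinarith), ← hxr]; ring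
    rw [e, ← Real.rpow_natCast, ← Real.rpow_mul (by positivity), Real.sqrt_eq_rpow]
    norm_num
  have h3 := b_tail1 ν x hν hx0
  have h4 := b_tail2 ν x hν hx0
  rw [(b_deriv ν x hν hx0).deriv, hθ, hquart, ← b_amp x (Real.sin β) hx0 hS,
    intervalIntegral.integral_neg]
  unfold besselJnu
  set I1 := ∫ t in (0:ℝ)..π, Real.sin t * Real.sin (x * Real.sin t - ν * t)
  set I2 := ∫ t in (0:ℝ)..π, Real.cos (x * Real.sin t - ν * t)
  set I3 := ∫ t in Set.Ioi (0:ℝ), Real.exp (-(x * Real.sinh t) - ν * t)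
  set I4 := ∫ t in Set.Ioi (0:ℝ), -Real.sinh t * Real.exp (-(x * Real.sinh t) - ν * t)
  set M := √2 * (Real.sin β * √(π / (x * Real.sin β)))
  set Sg := Real.sin (x * Real.sin β - ν * β - π / 4)
  have hq : |1 / π| ≤ 1 := by
    rw [abs_of_pos (by positivity), div_le_one (by positivity)]; linarith
  have hq2 : |Real.sin (ν * π) / π| ≤ 1 := by
    rw [abs_div, abs_of_pos Real.pi_pos, div_le_one (by positivity)]
    linarith [Real.abs_sin_le_one (ν * π)]
  have e : 1 / π * -I1 - Real.sin (ν * π) / π * I4 + σ / x * (1 / π * I2 - Real.sin (ν * π) / π * I3)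
      + 1 / π * M * Sg = -((1 / π) * (I1 - M * Sg)) + -((Real.sin (ν * π) / π) * I4)
      + (σ / x) * ((1 / π) * I2) + -((σ / x) * ((Real.sin (ν * π) / π) * I3)) := by ring
  rw [e]
  set u := 1 / (x * √x) with hu
  have hup : 0 < u := by positivity
  have hxx : 1 / x^2 ≤ u := by
    rw [hu]; apply one_div_le_one_div_of_le (by positivity); nlinarith
  have a1 : |(1 / π) * (I1 - M * Sg)| ≤ 1 * (K1 * u) := by
    rw [abs_mul]; gcongr
  have a2 : |(Real.sin (ν * π) / π) * I4| ≤ 1 * (4 * u) := by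
    rw [abs_mul]; gcongr
    refine h4.trans ?_
    linarith [(by ring : 4 / x^2 = 4 * (1 / x^2))]
  have hσx : |σ / x| = σ / x := abs_of_nonneg (by positivity)
  have a3 : |(σ / x) * ((1 / π) * I2)| ≤ σ * K2 * u := by
    rw [abs_mul, abs_mul, hσx]
    calc σ / x * (|1 / π| * |I2|) ≤ σ / x * (1 * (K2 * (1 / √x))) := by gcongr
      _ = _ := by rw [hu]; field_simp
  have a4 : |(σ / x) * ((Real.sin (ν * π) / π) * I3)| ≤ σ * u := by
    rw [abs_mul, abs_mul, hσx]
    calc σ / x * (|Real.sin (ν * π) / π| * |I3|) ≤ σ / x * (1 * (1 / x)) := by gcongr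
      _ = σ * (1 / x^2) := by field_simp
      _ ≤ _ := by gcongr
  have tot : ∀ a b c d : ℝ, |(-a) + (-b) + c + (-d)| ≤ |a| + |b| + |c| + |d| := by
    intro a b c d
    have := norm_add₄_le (a := -a) (b := -b) (c := c) (d := -d)
    simpa [Real.norm_eq_abs] using this
  refine (tot _ _ _ _).trans ?_
  have hfin : u ≤ √(x * Real.sin β) * x ^ (-(2:ℝ)) / √s0 := by
    have h5 : √x * √s0 ≤ √(x * Real.sin β) := by
      rw [← Real.sqrt_mul hx0.le]; apply Real.sqrt_le_sqrt; gcongr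
    have h6 : x ^ (-(2:ℝ)) = 1 / x^2 := by
      rw [Real.rpow_neg hx0.le]; norm_num
    rw [h6, le_div_iff₀ hss]
    calc u * √s0 = (√x * √s0) * (1 / x^2) := by
          rw [hu]
          have h7 : √x * √x = x := Real.mul_self_sqrt hx0.le
          field_simp
          linear_combination (-1 : ℝ) * h7
      _ ≤ _ := by gcongr
  calc _ ≤ 1 * (K1 * u) + 1 * (4 * u) + σ * K2 * u + σ * u := by gcongr
    _ = (K1 + 4 + σ * (K2 + 1)) * u := by ring
    _ ≤ (K1 + 4 + σ * (K2 + 1)) * (√(x * Real.sin β) * x ^ (-(2:ℝ)) / √s0) := by gcongr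
    _ = _ := by ring
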